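/- Let (R,m,K) be a standard graded K-algebra of characteristic p > 0 which is F-finite and F-pure, and let J ⊆ R be a homogeneous ideal. Then the limit lim_{e→∞} b_J(p^e)/p^e exists and equals fpt(J), where b_J(p^e) = max{r : J^r ⊄ I_e(R)}. -/

import Mathlib

/-!
Core definitions: standard graded algebras, Koszul-colimit model of graded local
cohomology nonvanishing, Frobenius splittings, F-purity, F-thresholds.
-/

open Filter

namespace FT

variable {R : Type*}

/-- Component of the (cochain) Koszul complex on `n` elements with values in `M`. -/
abbrev KC (n : ℕ) (M : Type*) (k : ℕ) : Type _ :=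
  {s : Finset (Fin n) // s.card = k} → M

/-- The Koszul cochain differential on the complex `K^•(f₁,…,fₙ; M)`. -/
def kd [CommRing R] {n : ℕ} (M : Type*) [AddCommGroup M] [Module R M]
    (f : Fin n → R) (k : ℕ) : KC n M k →ₗ[R] KC n M (k + 1) where
  toFun ω s := ∑ i ∈ s.1.attach,
    ((-1 : ℤ) ^ (s.1.filter (fun j => j < i.1)).card) •
      (f i.1 • ω ⟨s.1.erase i.1, by simp [Finset.card_erase_of_mem i.2, s.2]⟩)
  map_add' a b := by
    funext s
    simp [smul_add, Finset.sum_add_distrib]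
  map_smul' r a := by
    funext s
    simp only [Pi.smul_apply, RingHom.id_apply, Finset.smul_sum]
    refine Finset.sum_congr rfl fun i _ => ?_
    rw [smul_comm (f i.1) r, smul_comm ((-1 : ℤ) ^ (s.1.filter (fun j => j < i.1)).card) r]

/-- Transition maps of the direct system of Koszul complexes,
`K^•(f₁ᵗ,…,fₙᵗ; M) → K^•(f₁^{t+c},…,fₙ^{t+c}; M)`: on the component indexed by `s`
it is multiplication by `(∏_{i ∈ s} f i)^c`. -/
def ktr [CommRing R] {n : ℕ} (M : Type*) [AddCommGroup M] [Module R M]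
    (f : Fin n → R) (c k : ℕ) : KC n M k →ₗ[R] KC n M k where
  toFun ω s := (∏ i ∈ s.1, f i) ^ c • ω s
  map_add' a b := by funext s; simp
  map_smul' r a := by
    funext s
    simp only [Pi.smul_apply, RingHom.id_apply]
    rw [smul_comm]

/-- Koszul cocycles. -/
def koszulZ [CommRing R] {n : ℕ} (M : Type*) [AddCommGroup M] [Module R M]
    (f : Fin n → R) (i : ℕ) : Submodule R (KC n M i) :=
  LinearMap.ker (kd M f i)

/-- Koszul coboundaries. -/
def koszulB [CommRing R] {n : ℕ} (M : Type*) [AddCommGroup M] [Module R M]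
    (f : Fin n → R) : (i : ℕ) → Submodule R (KC n M i)
  | 0 => ⊥
  | (i + 1) => LinearMap.range (kd M f i)

end FT

namespace FT

variable {K R : Type*}

section Graded

variable [Field K] [CommRing R] [Algebra K R]

/-- Extension of a grading `𝒜 : ℕ → Submodule K R` to integer degrees (zero in
negative degrees). -/
def zdeg (𝒜 : ℕ → Submodule K R) (j : ℤ) : Submodule K R :=
  if 0 ≤ j then 𝒜 j.toNat else ⊥

/-- `ω` is a homogeneous element of (internal) degree `j` of the `k`-th component of the
Koszul complex `K^•(x₁ᵗ,…,xₙᵗ; R)`, where the `xᵢ` have degree one; the component of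
`K^k` indexed by a subset `s` is `R(-t·k)`, so it consists of elements of `R` of degree
`j + t·k`. -/
def KCdeg (𝒜 : ℕ → Submodule K R) (t k : ℕ) (j : ℤ) {n : ℕ} (ω : KC n R k) : Prop :=
  ∀ s, ω s ∈ zdeg 𝒜 (j + t * k)

/-- `lcNonzero K R 𝒜 i j` says that the degree-`j` graded piece of the `i`-th local
cohomology module `H^i_m(R)` (with support in the irrelevant maximal ideal
`m = (𝒜 1)·R`) is nonzero.  Local cohomology is computed here as the direct limit over
`t` of the cohomology of the Koszul complexes `K^•(x₁ᵗ,…,xₙᵗ; R)` on a family of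
degree-one generators of `m`; a class of degree `j` is nonzero in the limit iff it is
represented by a homogeneous cocycle of degree `j` at some stage `t` whose image at
every later stage is not a coboundary. -/
def lcNonzero (K : Type*) (R : Type*) [Field K] [CommRing R] [Algebra K R]
    (𝒜 : ℕ → Submodule K R) (i : ℕ) (j : ℤ) : Prop :=
  ∃ (n : ℕ) (x : Fin n → R), (∀ l, x l ∈ 𝒜 1) ∧
    Ideal.span (Set.range x) = Ideal.span ((𝒜 1 : Submodule K R) : Set R) ∧
    ∃ (t : ℕ) (ω : KC n R i), 0 < t ∧
      ω ∈ koszulZ R (fun l => x l ^ t) i ∧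
      KCdeg 𝒜 t i j ω ∧
      ∀ c : ℕ, ktr R x c i ω ∉ koszulB R (fun l => x l ^ (t + c)) i

/-- A standard graded `K`-algebra: `R = ⊕ 𝒜 i` with `𝒜 0 = K` and `R` generated over
`K` by the finite-dimensional piece `𝒜 1`. -/
structure IsStandardGraded (K : Type*) (R : Type*) [Field K] [CommRing R] [Algebra K R]
    (𝒜 : ℕ → Submodule K R) : Prop where
  internal : DirectSum.IsInternal 𝒜
  mul_le : ∀ i j, 𝒜 i * 𝒜 j ≤ 𝒜 (i + j)
  deg0 : 𝒜 0 = 1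
  gen1 : Algebra.adjoin K ((𝒜 1 : Submodule K R) : Set R) = ⊤
  fg1 : (𝒜 1).FG

/-- The irrelevant maximal ideal of a standard graded algebra, generated by the
degree-one piece. -/
def irrIdeal (𝒜 : ℕ → Submodule K R) : Ideal R :=
  Ideal.span ((𝒜 1 : Submodule K R) : Set R)

/-- A homogeneous ideal: an ideal generated by homogeneous elements. -/
def IsHomogIdeal (𝒜 : ℕ → Submodule K R) (J : Ideal R) : Prop :=
  ∃ S : Set R, (∀ s ∈ S, ∃ d, s ∈ 𝒜 d) ∧ J = Ideal.span S

end Graded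

section Frobenius

variable [CommRing R]

/-- Under the identification of `R`-linear maps `R^{1/p^e} → R` with additive maps
`φ : R → R` satisfying `φ(r^{p^e}·x) = r·φ(x)`, the statement `FSplitsAt R p e f` says
that the inclusion of `R`-modules `f^{1/p^e}·R ⊆ R^{1/p^e}` splits, i.e. there is an
`R`-linear map `R^{1/p^e} → R` sending `f^{1/p^e}` to `1`. -/
def FSplitsAt (R : Type*) [CommRing R] (p e : ℕ) (f : R) : Prop :=
  ∃ φ : R →+ R, (∀ r x : R, φ (r ^ p ^ e * x) = r * φ x) ∧ φ f = 1

/-- `R` is `F`-pure (equivalently, for `F`-finite rings, `F`-split): the Frobenius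
`R → R^{1/p}` splits as a map of `R`-modules. -/
def IsFPureRing (R : Type*) [CommRing R] (p : ℕ) : Prop :=
  FSplitsAt R p 1 1

/-- `R` is `F`-finite: `R` is a finitely generated module over itself via the Frobenius
endomorphism, i.e. `R^{1/p}` is a finitely generated `R`-module. -/
def IsFFinite (R : Type*) [CommRing R] (p : ℕ) : Prop :=
  ∃ s : Finset R, ∀ x : R, ∃ c : R → R, x = ∑ y ∈ s, c y ^ p * y

/-- `R` is strongly `F`-regular: for every nonzero `f` there is `e` such that
`f^{1/p^e}·R → R^{1/p^e}` splits. -/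
def IsStronglyFRegular (R : Type*) [CommRing R] (p : ℕ) : Prop :=
  ∀ f : R, f ≠ 0 → ∃ e : ℕ, FSplitsAt R p e f

/-- The set of nonnegative reals `λ` such that the pair `(R, I^λ)` is `F`-pure. -/
def fptSet (R : Type*) [CommRing R] (p : ℕ) (I : Ideal R) : Set ℝ :=
  {lam : ℝ | 0 ≤ lam ∧
    ∀ᶠ e in atTop, ∃ f ∈ I ^ ⌊((p : ℝ) ^ e - 1) * lam⌋₊, FSplitsAt R p e f}

/-- The `F`-pure threshold of an ideal `I` (for `I` the irrelevant/maximal ideal this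
is the `F`-pure threshold of `R`). -/
noncomputable def fpt (R : Type*) [CommRing R] (p : ℕ) (I : Ideal R) : ℝ :=
  sSup (fptSet R p I)

/-- The set of `R`-linear maps `R^{1/p^e} → R`, identified with additive maps
`φ : R → R` satisfying `φ(r^{p^e}·x) = r·φ(x)`. -/
def frobHoms (R : Type*) [CommRing R] (p e : ℕ) : Set (R →+ R) :=
  {φ | ∀ r x : R, φ (r ^ p ^ e * x) = r * φ x}

/-- The ideal `I_e(R) = {r ∈ R | φ(r^{1/p^e}) ∈ m for all φ ∈ Hom_R(R^{1/p^e}, R)}`. -/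
def Ie (R : Type*) [CommRing R] (p : ℕ) (m : Ideal R) (e : ℕ) : Ideal R where
  carrier := {r : R | ∀ φ ∈ frobHoms R p e, φ r ∈ m}
  zero_mem' := by
    intro φ _
    simp
  add_mem' := by
    intro a b ha hb φ hφ
    rw [map_add]
    exact m.add_mem (ha φ hφ) (hb φ hφ)
  smul_mem' := by
    intro r x hx φ hφ
    have hψ : (φ.comp (AddMonoidHom.mulLeft r)) ∈ frobHoms R p e := by
      intro c y
      simp only [AddMonoidHom.coe_comp, AddMonoidHom.coe_mulLeft, Function.comp_apply]
      rw [mul_left_comm, hφ]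
    simpa using hx _ hψ

/-- The splitting prime `𝒫(R) = ⋂ₑ I_e(R)`. -/
def splittingPrime (R : Type*) [CommRing R] (p : ℕ) (m : Ideal R) : Ideal R :=
  ⨅ e : ℕ, Ie R p m e

/-- `b_J(p^e) = max{r | J^r ⊄ I_e(R)}`. -/
noncomputable def bJ (R : Type*) [CommRing R] (p : ℕ) (m J : Ideal R) (e : ℕ) : ℕ :=
  sSup {r : ℕ | ¬ J ^ r ≤ Ie R p m e}

/-- The Frobenius power `I^{[q]}`, generated by the `q`-th powers of the elements
of `I`. -/
def frobeniusPower (I : Ideal R) (q : ℕ) : Ideal R :=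
  Ideal.span ((fun x : R => x ^ q) '' (I : Set R))

/-- `ν_I(q) = max{r | I^r ⊄ m^{[q]}}`. -/
noncomputable def nu (m : Ideal R) (I : Ideal R) (q : ℕ) : ℕ :=
  sSup {r : ℕ | ¬ I ^ r ≤ frobeniusPower m q}

/-- An ideal `J` is compatible if `φ(J^{1/p^e}) ⊆ J` for every `e` and every
`φ ∈ Hom_R(R^{1/p^e}, R)`. -/
def IsCompatibleIdeal (R : Type*) [CommRing R] (p : ℕ) (J : Ideal R) : Prop :=
  ∀ e : ℕ, ∀ φ ∈ frobHoms R p e, ∀ x ∈ J, φ x ∈ J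

end Frobenius

section RegSeq

variable [CommRing R]

/-- `f 0, …, f (r-1)` is a regular sequence on `R`. -/
def IsRegularSeq (R : Type*) [CommRing R] {r : ℕ} (f : Fin r → R) : Prop :=
  (∀ (k : Fin r) (x : R), f k * x ∈ Ideal.span (f '' {j | j < k}) →
      x ∈ Ideal.span (f '' {j | j < k})) ∧
    Ideal.span (Set.range f) ≠ ⊤

/-- An `F`-pure regular sequence: a regular sequence such that each successive quotient
`R/(f 0, …, f k)` is `F`-pure. -/
def IsFPureRegSeq (R : Type*) [CommRing R] (p : ℕ) {r : ℕ} (f : Fin r → R) : Prop :=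
  IsRegularSeq R f ∧
    ∀ k : Fin r, IsFPureRing (R ⧸ Ideal.span (f '' {j | j ≤ k})) p

end RegSeq

end FT

namespace FT

open DirectSum
open scoped Pointwise

section Helpers

lemma span_pow_le_of_pow_mem {R : Type*} [CommRing R] (I : Ideal R) (q : ℕ) (s : Finset R)
    (h : ∀ x ∈ s, x ^ q ∈ I) : Ideal.span (s : Set R) ^ (s.card * q + 1) ≤ I := by
  classical
  induction s using Finset.induction_on with
  | empty => simp
  | insert a s ha ih =>
    rw [Finset.card_insert_of_notMem ha, Finset.coe_insert, Ideal.span_insert,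
      show (s.card + 1) * q + 1 = q + (s.card * q + 1) by ring]
    refine Ideal.sup_pow_add_le_pow_sup_pow.trans (sup_le ?_ ?_)
    · rw [Ideal.span_singleton_pow, Ideal.span_singleton_le_iff_mem]
      exact h a (Finset.mem_insert_self _ _)
    · exact ih fun x hx => h x (Finset.mem_insert_of_mem hx)

lemma pow_homog {K R : Type*} [Field K] [CommRing R] [Algebra K R]
    (𝒜 : ℕ → Submodule K R) [SetLike.GradedMonoid 𝒜] (J : Ideal R) (hJ : IsHomogIdeal 𝒜 J)
    (r : ℕ) : IsHomogIdeal 𝒜 (J ^ r) := by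
  obtain ⟨S, hS, rfl⟩ := hJ
  induction r with
  | zero =>
    refine ⟨{1}, ?_, ?_⟩
    · rintro s rfl
      exact ⟨0, SetLike.GradedOne.one_mem⟩
    · simp
  | succ r ih =>
    obtain ⟨T, hT, hT'⟩ := ih
    refine ⟨T * S, ?_, ?_⟩
    · rintro _ ⟨t, ht, s, hs, rfl⟩
      obtain ⟨a, ha⟩ := hT t ht
      obtain ⟨b, hb⟩ := hS s hs
      exact ⟨a + b, SetLike.GradedMul.mul_mem ha hb⟩
    · rw [pow_succ, hT', Ideal.span_mul_span']

/-- The degree `-d` component of `φ`. -/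
noncomputable def comp0 {K R : Type*} [Field K] [CommRing R] [Algebra K R]
    (𝒜 : ℕ → Submodule K R) [GradedAlgebra 𝒜] (q d : ℕ) (φ : R →+ R) : R →+ R :=
  (DirectSum.toAddMonoid (fun j => if d ≤ j ∧ q ∣ j - d then
    (GradedRing.proj 𝒜 ((j - d) / q)).comp (φ.comp (𝒜 j).subtype.toAddMonoidHom) else 0)).comp
    (decomposeAddEquiv 𝒜).toAddMonoidHom

lemma comp0_of_mem {K R : Type*} [Field K] [CommRing R] [Algebra K R]
    (𝒜 : ℕ → Submodule K R) [GradedAlgebra 𝒜] (q d : ℕ) (φ : R →+ R) (j : ℕ) (x : R)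
    (hx : x ∈ 𝒜 j) : comp0 𝒜 q d φ x =
      if d ≤ j ∧ q ∣ j - d then (decompose 𝒜 (φ x) ((j - d) / q) : R) else 0 := by
  have : decomposeAddEquiv 𝒜 x = DirectSum.of (fun i => 𝒜 i) j ⟨x, hx⟩ :=
    decompose_of_mem 𝒜 hx
  simp only [comp0, AddMonoidHom.comp_apply, AddEquiv.coe_toAddMonoidHom, this,
    DirectSum.toAddMonoid_of]
  split_ifs <;> simp [GradedRing.proj_apply]

lemma comp0_mem {K R : Type*} [Field K] [CommRing R] [Algebra K R]
    (𝒜 : ℕ → Submodule K R) [GradedAlgebra 𝒜] (p : ℕ) [Fact p.Prime] [CharP R p]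
    (e d : ℕ) (φ : R →+ R)
    (hφ : φ ∈ frobHoms R p e) : comp0 𝒜 (p ^ e) d φ ∈ frobHoms R p e := by
  have hq : 0 < p ^ e := pow_pos (Fact.out : p.Prime).pos e
  intro r x
  induction r using DirectSum.Decomposition.inductionOn 𝒜 with
  | zero => rw [zero_pow hq.ne']; simp
  | add r s hr hs => rw [add_pow_char_pow, add_mul, map_add, hr, hs, add_mul]
  | @homogeneous i r =>
    induction x using DirectSum.Decomposition.inductionOn 𝒜 with
    | zero => simp
    | add x y hx hy => rw [mul_add, map_add, hx, hy, map_add, mul_add]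
    | @homogeneous j x =>
      have hmem : (r : R) ^ p ^ e * x ∈ 𝒜 (p ^ e * i + j) := by
        refine SetLike.GradedMul.mul_mem ?_ x.2
        simpa using SetLike.pow_mem_graded (p ^ e) r.2
      rw [comp0_of_mem 𝒜 _ _ _ _ _ hmem, comp0_of_mem 𝒜 _ _ _ _ _ x.2, hφ]
      generalize p ^ e = q at *
      by_cases h1 : d ≤ j
      · have e1 : q * i + j - d = (j - d) + q * i := by omega
        have : d ≤ q * i + j := by omega
        have e2 : q ∣ (j - d) + q * i ↔ q ∣ j - d := Nat.dvd_add_left (dvd_mul_right q i)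
        simp only [h1, this, true_and, e1, e2]
        split_ifs
        · have e3 : (q * i + j - d) / q = (j - d) / q + i := by
            rw [e1, Nat.add_mul_div_left _ _ hq]
          rw [coe_decompose_mul_of_left_mem_of_le 𝒜 r.2 (e3 ▸ Nat.le_add_left _ _), e3, Nat.add_sub_cancel]
        · simp
      · simp only [h1, false_and, if_false, mul_zero]
        split_ifs with h2
        · apply coe_decompose_mul_of_left_mem_of_not_le 𝒜 r.2
          rw [not_le, Nat.div_lt_iff_lt_mul hq, mul_comm i q]
          have := h2.1
          omega
        · rfl

end Helpers

section Std

variable {K R : Type*} [Field K] [CommRing R] [Algebra K R]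
    {𝒜 : ℕ → Submodule K R}

lemma gradedMonoid_of (hSG : IsStandardGraded K R 𝒜) : SetLike.GradedMonoid 𝒜 where
  one_mem := by rw [hSG.deg0]; exact Submodule.one_le.mp le_rfl
  mul_mem := fun {i j a b} ha hb => hSG.mul_le i j (Submodule.mul_mem_mul ha hb)

lemma exists_sub_mem (hSG : IsStandardGraded K R 𝒜) (x : R) :
    ∃ k : K, x - algebraMap K R k ∈ irrIdeal 𝒜 := by
  have hx : x ∈ Algebra.adjoin K ((𝒜 1 : Submodule K R) : Set R) := by
    rw [hSG.gen1]; trivial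
  induction hx using Algebra.adjoin_induction with
  | mem x hx => exact ⟨0, by rw [map_zero, sub_zero]; exact Ideal.subset_span hx⟩
  | algebraMap r => exact ⟨r, by simp⟩
  | add x y _ _ hx hy =>
    obtain ⟨a, ha⟩ := hx
    obtain ⟨b, hb⟩ := hy
    refine ⟨a + b, ?_⟩
    have := Ideal.add_mem _ ha hb
    convert this using 1
    simp; ring
  | mul x y _ _ hx hy =>
    obtain ⟨a, ha⟩ := hx
    obtain ⟨b, hb⟩ := hy
    refine ⟨a * b, ?_⟩
    have := Ideal.add_mem _ (Ideal.mul_mem_left _ y ha)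
      (Ideal.mul_mem_left _ (algebraMap K R a) hb)
    convert this using 1
    simp; ring

lemma decompose_zero_of_mem [GradedAlgebra 𝒜] (x : R) (hx : x ∈ irrIdeal 𝒜) :
    (decompose 𝒜 x 0 : R) = 0 := by
  have : irrIdeal 𝒜 ≤ RingHom.ker (GradedRing.projZeroRingHom 𝒜) := by
    refine Ideal.span_le.mpr fun y hy => ?_
    change (decompose 𝒜 y 0 : R) = 0
    exact decompose_of_mem_ne 𝒜 hy (by norm_num)
  exact this hx

lemma exists_eq_add (hSG : IsStandardGraded K R 𝒜) [GradedAlgebra 𝒜] (x : R) :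
    ∃ k : K, x - algebraMap K R k ∈ irrIdeal 𝒜 ∧ (decompose 𝒜 x 0 : R) = algebraMap K R k := by
  obtain ⟨k, hk⟩ := exists_sub_mem hSG x
  refine ⟨k, hk, ?_⟩
  have h := decompose_zero_of_mem _ hk
  have hk0 : algebraMap K R k ∈ 𝒜 0 := by
    rw [hSG.deg0]; exact Submodule.algebraMap_mem k
  rw [decompose_sub, DirectSum.sub_apply, AddSubgroupClass.coe_sub,
    decompose_of_mem_same 𝒜 hk0, sub_eq_zero] at h
  exact h

lemma le_irr (hSG : IsStandardGraded K R 𝒜) [GradedAlgebra 𝒜] (J : Ideal R)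
    (hJ : IsHomogIdeal 𝒜 J) (hne : J ≠ ⊤) : J ≤ irrIdeal 𝒜 := by
  obtain ⟨S, hS, rfl⟩ := hJ
  refine Ideal.span_le.mpr fun s hs => ?_
  obtain ⟨d, hd⟩ := hS s hs
  obtain ⟨k, hk, hk'⟩ := exists_eq_add hSG s
  have hk0 : k = 0 := by
    rcases Nat.eq_zero_or_pos d with rfl | hpos
    · rw [decompose_of_mem_same 𝒜 hd] at hk'
      by_contra hne0
      apply hne
      refine Ideal.eq_top_of_isUnit_mem _ (Ideal.subset_span hs) ?_
      rw [hk']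
      exact (IsUnit.mk0 k hne0).map (algebraMap K R)
    · by_contra hne0
      rw [decompose_of_mem_ne 𝒜 hd hpos.ne'] at hk'
      have hu : IsUnit (0 : R) := hk' ▸ (IsUnit.mk0 k hne0).map (algebraMap K R)
      have := isUnit_zero_iff.mp hu
      apply hne
      rw [Ideal.eq_top_iff_one, ← this]
      exact zero_mem _
  simpa [hk0] using hk

lemma one_notMem (p : ℕ) (hp : p.Prime) [CharP R p] [GradedAlgebra 𝒜] :
    (1 : R) ∉ irrIdeal 𝒜 := by
  intro h
  have := decompose_zero_of_mem _ h
  rw [decompose_of_mem_same 𝒜 SetLike.GradedOne.one_mem] at this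
  have : Nontrivial R := CharP.nontrivial_of_char_ne_one hp.ne_one
  exact one_ne_zero ‹(1 : R) = 0›

/-- The key equivalence. -/
lemma not_le_iff (hSG : IsStandardGraded K R 𝒜) [GradedAlgebra 𝒜] (p : ℕ) (hp : p.Prime)
    [CharP R p] (J : Ideal R) (hJ : IsHomogIdeal 𝒜 J) (r e : ℕ) :
    ¬ J ^ r ≤ Ie R p (irrIdeal 𝒜) e ↔ ∃ f ∈ J ^ r, FSplitsAt R p e f := by
  haveI : Fact p.Prime := ⟨hp⟩
  constructor
  · intro h
    obtain ⟨S, hS, hS'⟩ := pow_homog 𝒜 J hJ r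
    rw [hS', Ideal.span_le, Set.not_subset] at h
    obtain ⟨f, hf, hfI⟩ := h
    obtain ⟨d, hd⟩ := hS f hf
    refine ⟨f, hS' ▸ Ideal.subset_span hf, ?_⟩
    have : ¬ ∀ φ ∈ frobHoms R p e, φ f ∈ irrIdeal 𝒜 := hfI
    push Not at this
    obtain ⟨φ, hφ, hφf⟩ := this
    obtain ⟨k, hk, hk'⟩ := exists_eq_add hSG (φ f)
    have hk0 : k ≠ 0 := by
      rintro rfl
      apply hφf
      simpa using hk
    have hψ := comp0_mem 𝒜 p e d φ hφ
    refine ⟨(AddMonoidHom.mulLeft (algebraMap K R k⁻¹)).comp (comp0 𝒜 (p ^ e) d φ), ?_, ?_⟩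
    · intro r x
      simp only [AddMonoidHom.coe_comp, AddMonoidHom.coe_mulLeft, Function.comp_apply]
      rw [hψ r x, mul_left_comm]
    · simp only [AddMonoidHom.coe_comp, AddMonoidHom.coe_mulLeft, Function.comp_apply]
      rw [comp0_of_mem 𝒜 _ _ _ _ _ hd]
      rw [if_pos ⟨le_rfl, by simp⟩, Nat.sub_self, Nat.zero_div, hk', ← map_mul,
        inv_mul_cancel₀ hk0, map_one]
  · rintro ⟨f, hf, φ, hφ, hφf⟩ hle
    have : φ f ∈ irrIdeal 𝒜 := hle hf φ hφ
    rw [hφf] at this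
    exact one_notMem p hp this

lemma fsplits_succ (p e : ℕ) (hFP : IsFPureRing R p) (f : R)
    (h : FSplitsAt R p e f) : FSplitsAt R p (e + 1) (f ^ p) := by
  obtain ⟨θ, hθ, hθ1⟩ := hFP
  obtain ⟨φ, hφ, hφf⟩ := h
  refine ⟨φ.comp θ, ?_, ?_⟩
  · intro r x
    have := hθ (r ^ p ^ e) x
    rw [pow_one, ← pow_mul, ← pow_succ] at this
    simp only [AddMonoidHom.coe_comp, Function.comp_apply, this, hφ]
  · have := hθ f 1
    rw [pow_one, mul_one, hθ1, mul_one] at this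
    simp [this, hφf]

lemma fsplits_one (p : ℕ) (hFP : IsFPureRing R p) (e : ℕ) : FSplitsAt R p e 1 := by
  induction e with
  | zero => exact ⟨AddMonoidHom.id R, by simp, by simp⟩
  | succ e ih => simpa using fsplits_succ p e hFP 1 ih

lemma bound (hSG : IsStandardGraded K R 𝒜) (p : ℕ) (J : Ideal R) (hJ : J ≤ irrIdeal 𝒜) :
    ∃ n : ℕ, ∀ e r, ¬ J ^ r ≤ Ie R p (irrIdeal 𝒜) e → r ≤ n * p ^ e := by
  obtain ⟨s, hs⟩ := hSG.fg1
  have hm : irrIdeal 𝒜 ≤ Ideal.span (s : Set R) := by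
    refine Ideal.span_le.mpr fun y hy => ?_
    have hy : y ∈ Submodule.span K (s : Set R) := hs ▸ hy
    exact Submodule.span_subset_span K R (s : Set R) hy
  refine ⟨s.card, fun e r h => ?_⟩
  by_contra hlt
  push Not at hlt
  apply h
  refine (Ideal.pow_le_pow_right hlt).trans ?_
  refine (Ideal.pow_right_mono (hJ.trans hm) _).trans
    (span_pow_le_of_pow_mem _ _ _ fun x hx φ hφ => ?_)
  have := hφ x 1
  rw [mul_one] at this
  rw [this]
  apply Ideal.mul_mem_right
  apply Ideal.subset_span
  rw [← hs]
  exact Submodule.subset_span hx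

end Std

end FT

open FT Filter in
/-- Let `(R, m, K)` be a standard graded `K`-algebra of prime
characteristic `p` which is `F`-finite and `F`-pure, and let `J ⊆ R` be a homogeneous
ideal.  Then `lim_{e→∞} b_J(p^e)/p^e` exists and equals the `F`-pure threshold
`fpt(J)`, where `b_J(p^e) = max{r | J^r ⊄ I_e(R)}`. -/
theorem tendsto_bJ_div_pow_fpt
    (K R : Type*) [Field K] [CommRing R] [Algebra K R]
    (𝒜 : ℕ → Submodule K R) (hSG : IsStandardGraded K R 𝒜)
    (p : ℕ) (hp : p.Prime) [CharP R p]
    (hFF : IsFFinite R p) (hFP : IsFPureRing R p)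
    (J : Ideal R) (hJ : IsHomogIdeal 𝒜 J) :
    Tendsto (fun e : ℕ => (bJ R p (irrIdeal 𝒜) J e : ℝ) / (p : ℝ) ^ e) atTop
      (nhds (fpt R p J)) := by
  haveI := gradedMonoid_of hSG
  letI : GradedAlgebra 𝒜 := { gradedMonoid_of hSG, hSG.internal.chooseDecomposition with }
  have hp0 : (0 : ℝ) < p := by exact_mod_cast hp.pos
  have hp1 : (1 : ℝ) < p := by exact_mod_cast hp.one_lt
  have key := not_le_iff hSG p hp J hJ
  by_cases hT : J = ⊤
  · have hb : ∀ e, bJ R p (irrIdeal 𝒜) J e = 0 := by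
      intro e
      have : {r : ℕ | ¬ J ^ r ≤ Ie R p (irrIdeal 𝒜) e} = Set.univ := by
        ext r
        simp only [Set.mem_setOf_eq, Set.mem_univ, iff_true]
        rw [key]
        exact ⟨1, by rw [hT, ← Ideal.one_eq_top, one_pow]; simp, fsplits_one p hFP e⟩
      rw [bJ, this]
      exact Nat.sSup_of_not_bddAbove not_bddAbove_univ
    have hf : fpt R p J = 0 := by
      apply Real.sSup_of_not_bddAbove
      rintro ⟨B, hB⟩
      have : |B| + 1 ∈ fptSet R p J :=
        ⟨by positivity, Filter.Eventually.of_forall fun e =>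
          ⟨1, by rw [hT, ← Ideal.one_eq_top, one_pow]; simp, fsplits_one p hFP e⟩⟩
      have := hB this
      linarith [le_abs_self B]
    simp [hb, hf]
  · obtain ⟨n, hn⟩ := bound hSG p J (le_irr hSG J hJ hT)
    set b := bJ R p (irrIdeal 𝒜) J with hbdef
    have hbdd : ∀ e, BddAbove {r : ℕ | ¬ J ^ r ≤ Ie R p (irrIdeal 𝒜) e} :=
      fun e => ⟨n * p ^ e, fun r hr => hn e r hr⟩
    have hbmem : ∀ e, ¬ J ^ (b e) ≤ Ie R p (irrIdeal 𝒜) e := fun e =>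
      Nat.sSup_mem (s := {r : ℕ | ¬ J ^ r ≤ Ie R p (irrIdeal 𝒜) e})
        ⟨0, (key 0 e).mpr ⟨1, by simp, fsplits_one p hFP e⟩⟩ (hbdd e)
    have hble : ∀ e r, ¬ J ^ r ≤ Ie R p (irrIdeal 𝒜) e → r ≤ b e :=
      fun e r hr => le_csSup (hbdd e) hr
    have hstep : ∀ e, b e * p ≤ b (e + 1) := by
      intro e
      obtain ⟨f, hf, hfs⟩ := (key _ _).mp (hbmem e)
      refine hble _ _ ((key _ _).mpr ⟨f ^ p, ?_, fsplits_succ p e hFP f hfs⟩)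
      rw [pow_mul]
      exact Ideal.pow_mem_pow hf p
    set u : ℕ → ℝ := fun e => (b e : ℝ) / (p : ℝ) ^ e with hu
    have hmono : Monotone u := by
      refine monotone_nat_of_le_succ fun e => ?_
      have h1 : (b e : ℝ) * p ≤ b (e + 1) := by exact_mod_cast hstep e
      simp only [hu]
      rw [div_le_div_iff₀ (by positivity) (by positivity), pow_succ]
      have h2 : (0 : ℝ) < (p : ℝ) ^ e := by positivity
      nlinarith
    have hub : BddAbove (Set.range u) := by
      refine ⟨n, ?_⟩
      rintro _ ⟨e, rfl⟩
      simp only [hu]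
      rw [div_le_iff₀ (by positivity)]
      exact_mod_cast hn e _ (hbmem e)
    have hlim := tendsto_atTop_ciSup hmono hub
    set L := ⨆ e, u e with hL
    have hL0 : 0 ≤ L := le_trans (by simp only [hu]; positivity) (le_ciSup hub 0)
    have hpinv : Tendsto (fun e : ℕ => ((p : ℝ) ^ e)⁻¹) atTop (nhds 0) :=
      (tendsto_pow_atTop_atTop_of_one_lt hp1).inv_tendsto_atTop
    have hupper : ∀ lam ∈ fptSet R p J, lam ≤ L := by
      rintro lam ⟨h0, hev⟩
      have ht : Tendsto (fun e : ℕ => lam - (lam + 1) * ((p : ℝ) ^ e)⁻¹) atTop (nhds lam) := by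
        simpa using (tendsto_const_nhds (x := lam)).sub (hpinv.const_mul (lam + 1))
      refine le_of_tendsto_of_tendsto ht hlim ?_
      filter_upwards [hev] with e he
      have h1 := hble e _ ((key _ _).mpr he)
      have h2 := Nat.lt_floor_add_one (((p : ℝ) ^ e - 1) * lam)
      have h3 : ((⌊((p : ℝ) ^ e - 1) * lam⌋₊ : ℕ) : ℝ) ≤ b e := by exact_mod_cast h1
      have h4 : (0 : ℝ) < (p : ℝ) ^ e := by positivity
      simp only [hu]
      rw [le_div_iff₀ h4, sub_mul, mul_assoc, inv_mul_cancel₀ h4.ne']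
      nlinarith
    have hzero : (0 : ℝ) ∈ fptSet R p J :=
      ⟨le_rfl, Filter.Eventually.of_forall fun e => ⟨1, by simp, fsplits_one p hFP e⟩⟩
    have hbddf : BddAbove (fptSet R p J) := ⟨L, hupper⟩
    have hfpt : fpt R p J = L := by
      apply le_antisymm (csSup_le ⟨0, hzero⟩ hupper)
      by_contra hlt
      push Not at hlt
      obtain ⟨lam, hl1, hl2⟩ := exists_between hlt
      have hf0 : 0 ≤ fpt R p J := le_csSup hbddf hzero
      have hlam0 : 0 ≤ lam := hf0.trans hl1.le
      have hmem : lam ∈ fptSet R p J := by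
        refine ⟨hlam0, ?_⟩
        filter_upwards [hlim.eventually (lt_mem_nhds hl2)] with e he
        obtain ⟨f, hf, hfs⟩ := (key _ _).mp (hbmem e)
        refine ⟨f, Ideal.pow_le_pow_right ?_ hf, hfs⟩
        have h4 : (0 : ℝ) < (p : ℝ) ^ e := by positivity
        simp only [hu] at he
        rw [lt_div_iff₀ h4] at he
        apply Nat.floor_le_of_le
        nlinarith
      exact absurd (le_csSup hbddf hmem) (not_le.mpr hl1)
    rw [hfpt]
    exact hlim
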